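/- (Per-step loss of greedy restricted to a reduced set.) Let V be a finite set, f : 2^V → ℝ a submodular set function, ε ≥ 0, and V* ⊆ V. Let S ⊆ V* with S ≠ V*, and let u ∈ V*∖S satisfy f(u|S) ≥ f(x|S) for all x ∈ V*∖S. Let v ∈ V∖(V*∪S). If there exists x ∈ V*∖S with w_{xv} ≤ ε, then f(v|S) ≤ f(u|S) + ε. -/

import Mathlib

open Finset

variable {α : Type*}

/-- `f` is submodular on subsets of the ground set `V`. -/
def Submod [DecidableEq α] (V : Finset α) (f : Finset α → ℝ) : Prop :=
  ∀ A B : Finset α, A ⊆ B → B ⊆ V → ∀ v ∈ V, v ∉ B →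
    f (insert v B) - f B ≤ f (insert v A) - f A

/-- Marginal gain `f(v|S) = f(S ∪ {v}) - f(S)`. -/
def gain [DecidableEq α] (f : Finset α → ℝ) (v : α) (S : Finset α) : ℝ :=
  f (insert v S) - f S

/-- Submodularity-graph edge weight `w_{uv} = f(v|u) - f(u|V∖u)`. -/
def w [DecidableEq α] (f : Finset α → ℝ) (V : Finset α) (u v : α) : ℝ :=
  gain f v {u} - gain f u (V.erase u)

/-- Conditional edge weight `w_{uv|S} = f(v|S ∪ {u}) - f(u|V∖u)`. -/
def wS [DecidableEq α] (f : Finset α → ℝ) (V S : Finset α) (u v : α) : ℝ :=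
  gain f v (insert u S) - gain f u (V.erase u)

theorem stmt_9 [DecidableEq α] (V : Finset α) (f : Finset α → ℝ)
    (hsub : Submod V f) (ε : ℝ) (hε : 0 ≤ ε)
    (Vstar : Finset α) (hVstarV : Vstar ⊆ V)
    (S : Finset α) (hSVstar : S ⊆ Vstar) (hSne : S ≠ Vstar)
    (u : α) (hu : u ∈ Vstar \ S) (humax : ∀ x ∈ Vstar \ S, gain f x S ≤ gain f u S)
    (v : α) (hv : v ∈ V \ (Vstar ∪ S))
    (hx : ∃ x ∈ Vstar \ S, w f V x v ≤ ε) :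
    gain f v S ≤ gain f u S + ε := by
  obtain ⟨x, hx, hw⟩ := hx
  have hmax := humax x hx
  simp only [mem_sdiff, mem_union, not_or] at hx hv
  have hxV : x ∈ V := hVstarV hx.1
  have hvx : v ≠ x := fun h => hv.2.1 (h ▸ hx.1)
  have hSV : S ⊆ V := hSVstar.trans hVstarV
  have h_v := hsub {x} (insert x S) (by simp) (insert_subset hxV hSV) v hv.1
    (by simp [hvx, hv.2.2])
  have h_x := hsub (insert v S) (V.erase x)
    (subset_erase.2 ⟨insert_subset hv.1 hSV, by simp [hvx.symm, hx.2]⟩)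
    (erase_subset _ _) x hxV (notMem_erase _ _)
  rw [Finset.insert_comm x v S] at h_x
  unfold w at hw
  unfold gain at *
  linarith
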